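/- Let G > 0, K, γ ≥ 0, σ_Y > 0 and ε⁰ ≥ 0 be real numbers; set a = γ/(2G+γ), κ = 1 − (2G/σ_Y)·ε⁰ and b = 1 − a·κ. Define M(E) = 2G·E + (K − (2/3)G)·tr(E)·Id and the plastic-branch projector map f(E) = (a + b·σ_Y/‖M(E)^dev‖)·M(E)^dev + (1/3)·tr(M(E))·Id on real 3×3 matrices. Then at every E₀ with M(E₀)^dev ≠ 0, f is Fréchet differentiable and its derivative is H ↦ a·C_G[H] + C_K[H] + (b·σ_Y/‖M(E₀)^dev‖)·( C_G[H] − 2G·⟨M(E₀)^dev, H⟩·M(E₀)^dev/‖M(E₀)^dev‖² ), where C_G[H] = 2G·(H − (1/3)·tr(H)·Id) and C_K[H] = K·tr(H)·Id. -/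

import Mathlib

open Matrix

noncomputable section

/-- Real 3×3 matrices. -/
abbrev Mat3 : Type := Matrix (Fin 3) (Fin 3) ℝ

/-- Frobenius inner product ⟨A, B⟩ = tr(Aᵀ B). -/
def finner (A B : Mat3) : ℝ := (Aᵀ * B).trace

/-- Frobenius norm ‖A‖ = √⟨A, A⟩. -/
def fnorm (A : Mat3) : ℝ := Real.sqrt (finner A A)

/-- Deviatoric part A^dev = A − (1/3)·tr(A)·Id. -/
def dev (A : Mat3) : Mat3 := A - (A.trace / 3) • (1 : Mat3)

attribute [local instance] Matrix.frobeniusNormedAddCommGroup Matrix.frobeniusNormedSpace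

theorem finner_comm (A B : Mat3) : finner A B = finner B A := by
  simp only [finner, Matrix.trace, Matrix.diag, Matrix.mul_apply, Matrix.transpose_apply, mul_comm]

theorem finner_self_pos {A : Mat3} (hA : A ≠ 0) : 0 < finner A A := by
  have h : finner A A = ∑ j, ∑ i, A i j ^ 2 := by
    simp only [finner, Matrix.trace, Matrix.diag, Matrix.mul_apply, Matrix.transpose_apply, sq]
  have h0 : 0 ≤ finner A A := by rw [h]; positivity
  refine lt_of_le_of_ne h0 fun he => hA ?_
  rw [h] at he
  ext i j
  have hj := (Finset.sum_eq_zero_iff_of_nonneg fun j _ =>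
    Finset.sum_nonneg fun i _ => sq_nonneg (A i j)).1 he.symm j (Finset.mem_univ j)
  have hi := (Finset.sum_eq_zero_iff_of_nonneg fun i _ => sq_nonneg (A i j)).1 hj i
    (Finset.mem_univ i)
  simpa using hi

theorem trace_dev (A : Mat3) : (dev A).trace = 0 := by
  simp [dev, Matrix.trace_sub, Matrix.trace_smul]

/-- The Frobenius inner product as a bilinear map. -/
def finnerBilin : Mat3 →ₗ[ℝ] Mat3 →ₗ[ℝ] ℝ :=
  LinearMap.mk₂ ℝ finner
    (fun A B C => by simp [finner, Matrix.add_mul])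
    (fun c A B => by simp [finner])
    (fun A B C => by simp [finner, Matrix.mul_add])
    (fun c A B => by simp [finner])

/-- The deviatoric projection as a linear map. -/
def devLin : Mat3 →ₗ[ℝ] Mat3 :=
  LinearMap.id - ((1 / 3 : ℝ) • Matrix.traceLinearMap (Fin 3) ℝ ℝ).smulRight (1 : Mat3)

theorem devLin_apply (A : Mat3) : devLin A = dev A := by
  simp only [devLin, dev, LinearMap.sub_apply, LinearMap.id_apply, LinearMap.smulRight_apply,
    LinearMap.smul_apply, Matrix.traceLinearMap_apply, smul_eq_mul]
  congr 2
  ring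

theorem finner_dev_right {A : Mat3} (hA : A.trace = 0) (B : Mat3) :
    finner A (dev B) = finner A B := by
  simp [finner, dev, Matrix.mul_sub, Matrix.trace_sub, Matrix.trace_transpose, hA]

theorem dev_stress (g l : ℝ) (E : Mat3) : dev (g • E + l • (1 : Mat3)) = g • dev E := by
  ext i j
  simp [dev, Matrix.trace_add, Matrix.trace_smul]
  ring

/-- The consistent (plastic) tangent: Fréchet derivative of the plastic branch of the
rate-independent projector with linear isotropic hardening. -/
theorem plastic_tangent
    (G K γ σY ε₀ : ℝ) (hG : 0 < G) (hγ : 0 ≤ γ) (hσY : 0 < σY) (hε₀ : 0 ≤ ε₀)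
    (a κ b : ℝ)
    (ha : a = γ / (2 * G + γ)) (hκ : κ = 1 - (2 * G / σY) * ε₀) (hb : b = 1 - a * κ)
    (Mf : Mat3 → Mat3)
    (hMf : ∀ E, Mf E = (2 * G) • E + ((K - (2 / 3) * G) * E.trace) • (1 : Mat3))
    (CG CK : Mat3 → Mat3)
    (hCG : ∀ H, CG H = (2 * G) • (H - (H.trace / 3) • (1 : Mat3)))
    (hCK : ∀ H, CK H = (K * H.trace) • (1 : Mat3))
    (f : Mat3 → Mat3)
    (hf : ∀ E, f E = (a + b * σY / fnorm (dev (Mf E))) • dev (Mf E)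
          + ((Mf E).trace / 3) • (1 : Mat3))
    (E₀ : Mat3) (h : dev (Mf E₀) ≠ 0) :
    ∃ L : Mat3 →L[ℝ] Mat3,
      HasFDerivAt f L E₀ ∧
        ∀ H : Mat3,
          L H = a • CG H + CK H
            + (b * σY / fnorm (dev (Mf E₀))) •
              (CG H - (2 * G * finner (dev (Mf E₀)) H / fnorm (dev (Mf E₀)) ^ 2) •
                dev (Mf E₀)) := by
  
  have hD : ∀ E, dev (Mf E) = (2 * G) • dev E := fun E => by rw [hMf, dev_stress]
  have hC : ∀ H, CG H = (2 * G) • dev H := hCG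
  have hT : ∀ E, (Mf E).trace / 3 = K * E.trace := fun E => by
    rw [hMf]
    simp [Matrix.trace_add, Matrix.trace_smul]
    ring
  let C : Mat3 →L[ℝ] Mat3 := LinearMap.toContinuousLinearMap ((2 * G) • devLin)
  have hCC : ∀ E, C E = (2 * G) • dev E := fun E => by
    rw [← devLin_apply]; rfl
  let T : Mat3 →L[ℝ] Mat3 := LinearMap.toContinuousLinearMap
    ((K • Matrix.traceLinearMap (Fin 3) ℝ ℝ).smulRight (1 : Mat3))
  have hTT : ∀ E, T E = (K * E.trace) • (1 : Mat3) := fun E => rfl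
  let B : Mat3 →L[ℝ] Mat3 →L[ℝ] ℝ := finnerBilin.toContinuousBilinearMap
  have hB : ∀ X Y, B X Y = finner X Y := fun X Y => rfl
  have hfe : f = fun E => (a + b * σY * (Real.sqrt (B (C E) (C E)))⁻¹) • C E + T E := by
    funext E
    rw [hf, hT, hTT, hD, ← hCC, hB, fnorm, div_eq_mul_inv]
  have hq : 0 < finner (C E₀) (C E₀) := finner_self_pos (by rwa [hCC, ← hD])
  have hs : 0 < Real.sqrt (finner (C E₀) (C E₀)) := Real.sqrt_pos.2 hq
  have dC : HasFDerivAt (fun E => C E) C E₀ := C.hasFDerivAt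
  have dT : HasFDerivAt (fun E => T E) T E₀ := T.hasFDerivAt
  have dq := B.hasFDerivAt_of_bilinear dC dC
  have dn := (hasDerivAt_inv (x := Real.sqrt (B (C E₀) (C E₀))) hs.ne').comp_hasFDerivAt E₀
    (dq.sqrt hq.ne')
  have df := (((dn.const_mul (b * σY)).const_add a).smul dC).add dT
  refine ⟨_, by rw [hfe]; exact df, fun H => ?_⟩
  have hsym : finner (C H) (C E₀) = 2 * G * finner (C E₀) H := by
    have htr : (C E₀).trace = 0 := by rw [hCC, Matrix.trace_smul, trace_dev, smul_zero]
    rw [finner_comm, ← finner_dev_right htr H, hCC H]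
    simp [finner]
  have hsym' : finner (C E₀) (C H) = 2 * G * finner (C E₀) H := by rw [finner_comm, hsym]
  rw [hD, ← hCC, hC, ← hCC, hCK, ← hTT, fnorm]
  set n := Real.sqrt (finner (C E₀) (C E₀))
  change (a + b * σY * n⁻¹) • C H + ((b * σY) * (-(n ^ 2)⁻¹ * (1 / (2 * n) *
    (finner (C E₀) (C H) + finner (C H) (C E₀))))) • C E₀ + T H = _
  rw [hsym, hsym']
  ext i j
  simp only [Matrix.add_apply, Matrix.sub_apply, Matrix.smul_apply, smul_eq_mul]
  field_simp
  ring
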